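/- For any ε > 0, Σ_{k=1}^{h} (h−k) 𝔖(k) = (1/2) h² − (1/2) h log h + A h + O(h^{1/2+ε}) as h → ∞, where A = (1/2)(1 − C₀ − log 2π) and C₀ is Euler's constant. -/

import Mathlib

open Real MeasureTheory

/-- The singular series of the twin prime / Goldbach type problems. -/
noncomputable def singularSeries (d : ℕ) : ℝ :=
  if Even d then
    2 * (∏' p : Nat.Primes, if 2 < (p : ℕ) then (1 - 1 / ((p : ℝ) - 1) ^ 2) else 1) *
      ∏ p ∈ d.primeFactors.filter (fun p => 2 < p), ((p : ℝ) - 1) / ((p : ℝ) - 2)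
  else 0

/-- The constant `B = -C₀ - log 2π`. -/
noncomputable def Bconst : ℝ := -Real.eulerMascheroniConstant - Real.log (2 * Real.pi)

/-- `ε(y) = Σ_{h ≤ y} 𝔖(h) - y + (1/2) log y`. -/
noncomputable def epsErr (y : ℝ) : ℝ :=
  (∑ h ∈ Finset.Icc 1 ⌊y⌋₊, singularSeries h) - y + Real.log y / 2

/-- `f(y) = ∫_1^y (ε(u) - B/2) du`. -/
noncomputable def fErr (y : ℝ) : ℝ := ∫ u in (1 : ℝ)..y, (epsErr u - Bconst / 2)

lemma abs_sub_le_of_telescoping {u v : ℕ → ℝ} {L : ℝ} (hu : Filter.Tendsto u .atTop (nhds L))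
    (hv : Filter.Tendsto v .atTop (nhds 0))
    (h : ∀ n : ℕ, 1 ≤ n → |u (n + 1) - u n| ≤ v n - v (n + 1)) {n : ℕ} (hn : 1 ≤ n) :
    |u n - L| ≤ v n := by
  have step : ∀ k : ℕ, |u (n + k) - u n| ≤ v n - v (n + k) := by
    intro k
    induction k with
    | zero => simp
    | succ k ih =>
      have h1 := h (n + k) (by omega)
      have h2 := abs_sub_le (u (n + k + 1)) (u (n + k)) (u n)
      rw [← add_assoc]
      linarith
  have hu' : Filter.Tendsto (fun k => |u (k + n) - u n|) .atTop (nhds |L - u n|) :=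
    (((Filter.tendsto_add_atTop_iff_nat n).2 hu).sub_const _).abs
  have hv' : Filter.Tendsto (fun k => v n - v (k + n)) .atTop (nhds (v n - 0)) :=
    ((Filter.tendsto_add_atTop_iff_nat n).2 hv).const_sub _
  have := le_of_tendsto_of_tendsto' hu' hv' fun k => by simpa [add_comm] using step k
  rwa [abs_sub_comm, sub_zero] at this

lemma tendsto_const_div_natCast_pow (c : ℝ) {k : ℕ} (hk : k ≠ 0) :
    Filter.Tendsto (fun n : ℕ => c / (n : ℝ) ^ k) .atTop (nhds 0) :=
  ((Filter.tendsto_pow_atTop hk).comp tendsto_natCast_atTop_atTop).const_div_atTop c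

lemma abs_log_succ_sub_log_sub_le {n : ℕ} (hn : 1 ≤ n) :
    |log ((n : ℝ) + 1) - log n - (1 / ((n : ℝ) + 1) + 1 / (2 * ((n : ℝ) + 1) ^ 2))| ≤
      1 / ((n : ℝ) * ((n : ℝ) + 1) ^ 2) := by
  have h0 : (0 : ℝ) < n := by exact_mod_cast hn
  have habs : |(1 : ℝ) / (n + 1)| = 1 / (n + 1) := abs_of_pos (by positivity)
  have h := abs_log_sub_add_sum_range_le (x := 1 / ((n : ℝ) + 1))
    (by rw [habs, div_lt_one (by positivity)]; linarith) 2
  rw [habs, Finset.sum_range_succ, Finset.sum_range_one,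
    show (1 : ℝ) - 1 / (n + 1) = n / (n + 1) by field_simp; ring,
    log_div h0.ne' (by positivity)] at h
  rw [abs_sub_comm]
  convert h using 1
  · congr 1
    simp only [div_pow, one_pow]
    norm_num
    ring
  · simp only [div_pow, one_pow]
    field_simp

lemma abs_harmonic_sub_le {n : ℕ} (hn : 1 ≤ n) :
    |(harmonic n : ℝ) - (log n + eulerMascheroniConstant + 1 / (2 * n))| ≤ 1 / (n : ℝ) ^ 2 := by
  have hu : Filter.Tendsto (fun n : ℕ => (harmonic n : ℝ) - log n - (1 / 2) / (n : ℝ) ^ 1) .atTop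
      (nhds (eulerMascheroniConstant - 0)) :=
    tendsto_harmonic_sub_log.sub (tendsto_const_div_natCast_pow _ one_ne_zero)
  have := abs_sub_le_of_telescoping hu (tendsto_const_div_natCast_pow 1 two_ne_zero) ?_ hn
  · convert this using 2
    field_simp
    ring
  · intro m hm
    have h0 : (0 : ℝ) < m := by exact_mod_cast hm
    have h := abs_log_succ_sub_log_sub_le hm
    rw [harmonic_succ]
    push_cast
    have e : (1 : ℝ) / m ^ 2 - 1 / (m + 1) ^ 2 =
        1 / (2 * m * (m + 1) ^ 2) + 1 / (m * (m + 1) ^ 2) + (m / 2 + 1) / (m ^ 2 * (m + 1) ^ 2) := by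
      field_simp
      ring
    have e3 : (0 : ℝ) ≤ (m / 2 + 1) / (m ^ 2 * (m + 1) ^ 2) := by positivity
    have e2 : (harmonic m : ℝ) + ((m : ℝ) + 1)⁻¹ - log (m + 1) - 1 / 2 / ((m : ℝ) + 1) ^ 1 -
        (harmonic m - log m - 1 / 2 / (m : ℝ) ^ 1) = 1 / (2 * m * (m + 1) ^ 2) -
        (log ((m : ℝ) + 1) - log m - (1 / ((m : ℝ) + 1) + 1 / (2 * ((m : ℝ) + 1) ^ 2))) := by
      field_simp
      ring
    rw [e2, e]
    have e4 : (0 : ℝ) ≤ 1 / (2 * m * (m + 1) ^ 2) := by positivity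
    rw [abs_le] at h ⊢
    constructor <;> linarith

lemma abs_sum_inv_sq_sub_le {n : ℕ} (hn : 1 ≤ n) :
    |∑ f ∈ Finset.Ioc 0 n, 1 / (f : ℝ) ^ 2 - (π ^ 2 / 6 - 1 / n + 1 / (2 * n ^ 2))| ≤
      1 / (n : ℝ) ^ 3 := by
  have hz : Filter.Tendsto (fun n : ℕ => ∑ f ∈ Finset.Ioc 0 n, 1 / (f : ℝ) ^ 2) .atTop
      (nhds (π ^ 2 / 6)) := by
    have := (Filter.tendsto_add_atTop_iff_nat 1).2 hasSum_zeta_two.tendsto_sum_nat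
    refine this.congr fun m => ?_
    rw [Finset.range_eq_Ico, Finset.sum_eq_sum_Ico_succ_bot (by omega)]
    simp only [Nat.cast_zero, ne_eq, OfNat.ofNat_ne_zero, not_false_eq_true, zero_pow, div_zero,
      zero_add]
    rfl
  have hu := (hz.add (tendsto_const_div_natCast_pow 1 one_ne_zero)).sub
    (tendsto_const_div_natCast_pow (1 / 2) two_ne_zero)
  have := abs_sub_le_of_telescoping hu (tendsto_const_div_natCast_pow 1 three_ne_zero) ?_ hn
  · convert this using 2
    field_simp
    ring
  · intro m hm
    have h0 : (0 : ℝ) < m := by exact_mod_cast hm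
    rw [Finset.sum_Ioc_succ_top (by omega)]
    push_cast
    have e2 : ∑ f ∈ Finset.Ioc 0 m, 1 / (f : ℝ) ^ 2 + 1 / ((m : ℝ) + 1) ^ 2 + 1 / ((m : ℝ) + 1) ^ 1
        - 1 / 2 / ((m : ℝ) + 1) ^ 2 - (∑ f ∈ Finset.Ioc 0 m, 1 / (f : ℝ) ^ 2 + 1 / (m : ℝ) ^ 1
        - 1 / 2 / (m : ℝ) ^ 2) = 1 / (2 * m ^ 2 * (m + 1) ^ 2) := by
      field_simp
      ring
    rw [e2, abs_of_pos (by positivity)]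
    have e : (1 : ℝ) / m ^ 3 - 1 / (m + 1) ^ 3 - 1 / (2 * m ^ 2 * (m + 1) ^ 2) =
        (5 / 2 * m ^ 2 + 5 / 2 * m + 1) / (m ^ 3 * (m + 1) ^ 3) := by
      field_simp
      ring
    have : (0 : ℝ) ≤ (5 / 2 * m ^ 2 + 5 / 2 * m + 1) / (m ^ 3 * (m + 1) ^ 3) := by positivity
    linarith

lemma abs_log_factorial_sub_le {n : ℕ} (hn : 1 ≤ n) :
    |log (n.factorial) - (n * log n - n + 1 / 2 * log (2 * π) + 1 / 2 * log n)| ≤ 1 / (n : ℝ) := by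
  have hu : Filter.Tendsto (fun n => log (Stirling.stirlingSeq n)) .atTop (nhds (log (√π))) :=
    Stirling.tendsto_stirlingSeq_sqrt_pi.log (by positivity)
  have := abs_sub_le_of_telescoping hu (tendsto_const_div_natCast_pow 1 one_ne_zero) ?_ hn
  · have h0 : (0 : ℝ) < n := by exact_mod_cast hn
    rw [pow_one] at this
    convert this using 2
    rw [Stirling.log_stirlingSeq_formula, log_sqrt pi_pos.le, log_mul two_ne_zero pi_ne_zero,
      log_mul two_ne_zero h0.ne', log_div h0.ne' (exp_ne_zero _), log_exp]
    ring
  · intro m hm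
    have h0 : (0 : ℝ) < m := by exact_mod_cast hm
    obtain ⟨k, rfl⟩ : ∃ k, m = k + 1 := ⟨m - 1, by omega⟩
    have h1 := Stirling.log_stirlingSeq_sdiff_le (k + 1)
    have h2 := Stirling.log_stirlingSeq'_antitone (Nat.le_succ k)
    simp only [Function.comp_apply, Nat.succ_eq_add_one] at h2
    rw [abs_sub_comm, abs_of_nonneg (by linarith)]
    refine h1.trans ?_
    push_cast at h0 ⊢
    rw [pow_one, pow_one, div_sub_div _ _ h0.ne' (by positivity),
      div_le_div_iff₀ (by positivity) (by positivity)]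
    nlinarith [mul_pos h0 (show (0:ℝ) < k + 1 + 1 by positivity)]

lemma sub_sq_half_le_log_one_add {u : ℝ} (hu : 0 ≤ u) : u - u ^ 2 / 2 ≤ log (1 + u) := by
  refine le_trans ?_ (le_log_one_add_of_nonneg hu)
  rw [le_div_iff₀ (by positivity)]
  nlinarith [pow_nonneg hu 3]

lemma one_add_mul_log_one_add_le {v : ℝ} (hv : 0 ≤ v) :
    (1 + v) * log (1 + v) ≤ v + v ^ 2 / 2 := by
  have h := self_le_sinh_iff.2 (log_nonneg (by linarith : 1 ≤ 1 + v))
  rw [sinh_log (by linarith)] at h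
  have h' := mul_le_mul_of_nonneg_left h (by linarith : 0 ≤ 1 + v)
  refine h'.trans (le_of_eq ?_)
  have : 1 + v ≠ 0 := by positivity
  field_simp
  ring

lemma le_one_add_mul_log_one_add {v : ℝ} (hv : 0 ≤ v) :
    v + v ^ 2 / 2 - v ^ 3 / 4 ≤ (1 + v) * log (1 + v) := by
  have h' := mul_le_mul_of_nonneg_left (le_log_one_add_of_nonneg hv) (by linarith : 0 ≤ 1 + v)
  refine le_trans ?_ h'
  rw [mul_div_assoc', le_div_iff₀ (by positivity)]
  nlinarith [pow_nonneg hv 4]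

lemma abs_mul_harmonic_floor_sub_le {y : ℝ} (hy : 1 ≤ y) :
    |y * harmonic ⌊y⌋₊ - ⌊y⌋₊ - (y * log y + eulerMascheroniConstant * y - y + 1 / 2)| ≤ 9 / y := by
  have hn1 : 1 ≤ ⌊y⌋₊ := (Nat.one_le_floor_iff y).2 hy
  have hle : (⌊y⌋₊ : ℝ) ≤ y := Nat.floor_le (by linarith)
  have hlt := Nat.lt_floor_add_one y
  have hH := abs_harmonic_sub_le hn1
  generalize ⌊y⌋₊ = n at *
  have hn : (1 : ℝ) ≤ n := by exact_mod_cast hn1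
  have h0 : (0 : ℝ) < n := by linarith
  set D := (harmonic n : ℝ) - (log n + eulerMascheroniConstant + 1 / (2 * n)) with hD
  obtain ⟨t, ht⟩ : ∃ t, t = y - n := ⟨_, rfl⟩
  have ht0 : 0 ≤ t := by linarith
  have ht1 : t ≤ 1 := by linarith
  have hyt : y = n * (1 + t / n) := by field_simp; linarith
  have hlog : log y = log n + log (1 + t / n) := by
    rw [← log_mul h0.ne' (by positivity), ← hyt]
  have hu : 0 ≤ t / n := by positivity
  have hl := sub_sq_half_le_log_one_add hu
  have hl' := log_le_sub_one_of_pos (by positivity : 0 < 1 + t / n)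
  set w := t / n - log (1 + t / n) with hw
  have hw0 : 0 ≤ w := by linarith
  have hw1 : w ≤ (t / n) ^ 2 / 2 := by linarith
  have hw2 : w ≤ 1 / (2 * n ^ 2) := by
    refine hw1.trans ?_
    rw [div_pow, div_div, div_le_div_iff₀ (by positivity) (by positivity)]
    have : t ^ 2 ≤ 1 := by nlinarith
    nlinarith [sq_nonneg (n : ℝ)]
  have hy2 : y ≤ 2 * n := by linarith
  have key : y * harmonic n - n - (y * log y + eulerMascheroniConstant * y - y + 1 / 2) =
      y * w - t ^ 2 / n + t / (2 * n) + y * D := by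
    have e1 : (harmonic n : ℝ) = D + (log n + eulerMascheroniConstant + 1 / (2 * n)) := by
      rw [hD]; ring
    have e2 : log (1 + t / n) = t / n - w := by rw [hw]; ring
    rw [hlog, e2, e1, show y = n + t by linarith]
    field_simp
    ring
  rw [key]
  have b1 : y * w ≤ 1 / n := by
    calc y * w ≤ 2 * n * (1 / (2 * n ^ 2)) := by gcongr
      _ = 1 / n := by field_simp
  have b1' : 0 ≤ y * w := by positivity
  have b2 : t ^ 2 / n ≤ 1 / n := by
    gcongr
    nlinarith
  have b2' : 0 ≤ t ^ 2 / n := by positivity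
  have b3 : t / (2 * n) ≤ 1 / (2 * n) := by gcongr
  have b3' : 0 ≤ t / (2 * n) := by positivity
  have b4 : |y * D| ≤ 2 / n := by
    rw [abs_mul, abs_of_pos (by linarith : 0 < y)]
    calc y * |D| ≤ 2 * n * (1 / n ^ 2) := by gcongr
      _ = 2 / n := by field_simp
  have b5 : (9 / 2) / n ≤ 9 / y := by
    rw [div_le_div_iff₀ h0 (by linarith)]
    linarith
  have b6 : (9 / 2) / (n : ℝ) = 1 / n + 1 / n + 1 / (2 * n) + 2 / n := by field_simp; norm_num
  have b7 : 0 < 1 / (n : ℝ) := by positivity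
  rw [abs_le] at b4 ⊢
  constructor <;> linarith

lemma abs_sum_sub_floor_le {y : ℝ} (hy : 0 ≤ y) :
    |∑ j ∈ Finset.Ioc 0 ⌊y⌋₊, (y - (j : ℝ)) - (y ^ 2 / 2 - y / 2)| ≤ 1 / 8 := by
  have hle : (⌊y⌋₊ : ℝ) ≤ y := Nat.floor_le hy
  have hlt := Nat.lt_floor_add_one y
  have hs : ∀ n : ℕ, ∑ j ∈ Finset.Ioc 0 n, (y - (j : ℝ)) = y * n - n * (n + 1) / 2 := by
    intro n
    induction n with
    | zero => simp
    | succ n ih =>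
      rw [Finset.sum_Ioc_succ_top (by omega), ih]
      push_cast
      ring
  rw [hs]
  generalize (⌊y⌋₊ : ℝ) = n at *
  rw [abs_le]
  constructor <;> nlinarith [sq_nonneg (y - n - 1 / 2), mul_nonneg (sub_nonneg.2 hle) (sub_nonneg.2 hlt.le)]

lemma sum_Ioc_hyperbola (F : ℕ → ℕ → ℝ) (N : ℕ) :
    ∑ f ∈ Finset.Ioc 0 N, ∑ j ∈ Finset.Ioc 0 (N / f), F f j =
      ∑ f ∈ Finset.Ioc 0 N.sqrt, ∑ j ∈ Finset.Ioc 0 (N / f), F f j +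
      ∑ j ∈ Finset.Ioc 0 N.sqrt, ∑ f ∈ Finset.Ioc 0 (N / j), F f j -
      ∑ f ∈ Finset.Ioc 0 N.sqrt, ∑ j ∈ Finset.Ioc 0 N.sqrt, F f j := by
  have hsN := Nat.sqrt_le_self N
  have inner : ∀ (G : ℕ → ℝ) (a : ℕ), 0 < a → ∑ b ∈ Finset.Ioc 0 (N / a), G b =
      ∑ b ∈ Finset.Ioc 0 N, if a * b ≤ N then G b else 0 := by
    intro G a ha
    rw [← Finset.sum_filter]
    congr 1
    ext b
    simp only [Finset.mem_Ioc, Finset.mem_filter, Nat.le_div_iff_mul_le ha, mul_comm b a]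
    constructor
    · rintro ⟨h1, h2⟩
      exact ⟨⟨h1, (Nat.le_mul_of_pos_left b ha).trans h2⟩, h2⟩
    · rintro ⟨⟨h1, _⟩, h2⟩
      exact ⟨h1, h2⟩
  have outer : ∀ G : ℕ → ℝ, ∑ a ∈ Finset.Ioc 0 N.sqrt, G a =
      ∑ a ∈ Finset.Ioc 0 N, if a ≤ N.sqrt then G a else 0 := by
    intro G
    rw [← Finset.sum_filter]
    congr 1
    ext b
    simp only [Finset.mem_Ioc, Finset.mem_filter]
    omega
  have e1 : ∑ f ∈ Finset.Ioc 0 N, ∑ j ∈ Finset.Ioc 0 (N / f), F f j =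
      ∑ f ∈ Finset.Ioc 0 N, ∑ j ∈ Finset.Ioc 0 N, if f * j ≤ N then F f j else 0 :=
    Finset.sum_congr rfl fun f hf => inner _ f (Finset.mem_Ioc.1 hf).1
  have e2 : ∑ f ∈ Finset.Ioc 0 N.sqrt, ∑ j ∈ Finset.Ioc 0 (N / f), F f j =
      ∑ f ∈ Finset.Ioc 0 N, ∑ j ∈ Finset.Ioc 0 N,
        if f ≤ N.sqrt then (if f * j ≤ N then F f j else 0) else 0 := by
    rw [outer]
    refine Finset.sum_congr rfl fun f hf => ?_
    rw [inner _ f (Finset.mem_Ioc.1 hf).1]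
    split_ifs <;> simp
  have e3 : ∑ j ∈ Finset.Ioc 0 N.sqrt, ∑ f ∈ Finset.Ioc 0 (N / j), F f j =
      ∑ f ∈ Finset.Ioc 0 N, ∑ j ∈ Finset.Ioc 0 N,
        if j ≤ N.sqrt then (if f * j ≤ N then F f j else 0) else 0 := by
    rw [outer, Finset.sum_comm]
    refine Finset.sum_congr rfl fun f hf => ?_
    rw [inner _ f (Finset.mem_Ioc.1 hf).1]
    simp_rw [mul_comm f]
    split_ifs <;> simp
  have e4 : ∑ f ∈ Finset.Ioc 0 N.sqrt, ∑ j ∈ Finset.Ioc 0 N.sqrt, F f j =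
      ∑ f ∈ Finset.Ioc 0 N, ∑ j ∈ Finset.Ioc 0 N,
        if f ≤ N.sqrt then (if j ≤ N.sqrt then F f j else 0) else 0 := by
    rw [outer]
    refine Finset.sum_congr rfl fun f hf => ?_
    rw [outer]
    split_ifs <;> simp
  rw [e1, e2, e3, e4, ← Finset.sum_add_distrib, ← Finset.sum_sub_distrib]
  refine Finset.sum_congr rfl fun f _ => ?_
  rw [← Finset.sum_add_distrib, ← Finset.sum_sub_distrib]
  refine Finset.sum_congr rfl fun j _ => ?_
  by_cases hf : f ≤ N.sqrt <;> by_cases hj : j ≤ N.sqrt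
  · have : f * j ≤ N := (Nat.mul_le_mul hf hj).trans (Nat.sqrt_le N)
    simp [hf, hj, this]
  · simp [hf, hj]
  · simp [hf, hj]
  · have : ¬ f * j ≤ N := by
      have := Nat.mul_le_mul (not_le.1 hf : N.sqrt + 1 ≤ f) (not_le.1 hj : N.sqrt + 1 ≤ j)
      have h2 := Nat.lt_succ_sqrt N
      exact not_le.2 (h2.trans_le this)
    simp [hf, hj, this]

/-- `divisorConvSum x = ∑_{fj ≤ x} (x / f - j)`, which is `∑_{n ≤ x} (x - n) σ₋₁(n)`. -/
noncomputable def divisorConvSum (x : ℝ) : ℝ :=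
  ∑ f ∈ Finset.Ioc 0 ⌊x⌋₊, ∑ j ∈ Finset.Ioc 0 (⌊x⌋₊ / f), (x / f - j)

/-- The main term in the asymptotic expansion of `divisorConvSum`. -/
noncomputable def divisorConvMain (x : ℝ) : ℝ :=
  π ^ 2 / 12 * x ^ 2 - x / 2 * log x +
    1 / 2 * (1 - eulerMascheroniConstant - log (2 * π)) * x

lemma sum_Ioc_harmonic (n : ℕ) : ∑ f ∈ Finset.Ioc 0 n, (1 : ℝ) / f = harmonic n := by
  rw [harmonic_eq_sum_Icc]
  push_cast
  simp only [one_div]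
  rfl

lemma sum_Ioc_natCast (n : ℕ) : ∑ j ∈ Finset.Ioc 0 n, (j : ℝ) = n * (n + 1) / 2 := by
  induction n with
  | zero => simp
  | succ n ih =>
    rw [Finset.sum_Ioc_succ_top (by omega), ih]
    push_cast
    ring

lemma sum_Ioc_log (n : ℕ) : ∑ j ∈ Finset.Ioc 0 n, log (j : ℝ) = log n.factorial := by
  induction n with
  | zero => simp
  | succ n ih =>
    rw [Finset.sum_Ioc_succ_top (by omega), ih, Nat.factorial_succ, Nat.cast_mul,
      log_mul (by positivity) (by positivity), add_comm]

lemma abs_sum_sub_sum_le {s : Finset ℕ} {a b : ℕ → ℝ} {c : ℝ} (h : ∀ i ∈ s, |a i - b i| ≤ c) :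
    |∑ i ∈ s, a i - ∑ i ∈ s, b i| ≤ s.card * c := by
  rw [← Finset.sum_sub_distrib, ← nsmul_eq_mul]
  exact (Finset.abs_sum_le_sum_abs _ _).trans (Finset.sum_le_card_nsmul _ _ _ h)

lemma hyperbola_combination_identity {n v s η ν γ ln lv c p r₁ r₂ : ℝ} (h0 : n ≠ 0) :
    ((n ^ 2 * (1 + v)) ^ 2 / 2 * (s + (p / 6 - 1 / n + 1 / (2 * n ^ 2))) -
      n ^ 2 * (1 + v) / 2 * (η + (ln + γ + 1 / (2 * n))) + r₁) +
      (n * (n ^ 2 * (1 + v) * (2 * ln + lv)) -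
      n ^ 2 * (1 + v) * (ν + (n * ln - n + 1 / 2 * c + 1 / 2 * ln)) +
      (γ - 1) * (n * (n ^ 2 * (1 + v))) + n * (n + 1) / 4 + r₂) -
      (n * (n ^ 2 * (1 + v)) * (η + (ln + γ + 1 / (2 * n))) - n * (n * (n + 1) / 2)) -
      (p / 12 * (n ^ 2 * (1 + v)) ^ 2 - n ^ 2 * (1 + v) / 2 * (2 * ln + lv) +
        1 / 2 * (1 - γ - c) * (n ^ 2 * (1 + v))) =
      (n ^ 2 * (1 + v)) ^ 2 / 2 * s -
        (n ^ 2 * (1 + v) / 2 + n * (n ^ 2 * (1 + v))) * η - n ^ 2 * (1 + v) * ν + r₁ + r₂ +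
      n ^ 3 * ((1 + v) * lv - v - v ^ 2 / 2) + n ^ 2 / 2 * ((1 + v) * lv - v - v ^ 2 / 2) +
      (n * v) ^ 2 / 2 - n * v / 4 := by
  field_simp
  ring

/-- The pieces of the hyperbola method assembled; `S`, `H`, `l` stand for
`∑_{f ≤ n} f⁻²`, the harmonic number and `log n!`. -/
lemma abs_hyperbola_combination_sub_main_le {n x S H l r₁ r₂ : ℝ} (hn : 1 ≤ n) (hx : n ^ 2 ≤ x)
    (hx' : x < (n + 1) ^ 2)
    (hS : |S - (π ^ 2 / 6 - 1 / n + 1 / (2 * n ^ 2))| ≤ 1 / n ^ 3)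
    (hH : |H - (log n + eulerMascheroniConstant + 1 / (2 * n))| ≤ 1 / n ^ 2)
    (hl : |l - (n * log n - n + 1 / 2 * log (2 * π) + 1 / 2 * log n)| ≤ 1 / n)
    (hr₁ : |r₁| ≤ n) (hr₂ : |r₂| ≤ 9 * n) :
    |(x ^ 2 / 2 * S - x / 2 * H + r₁) + (n * (x * log x) - x * l +
      (eulerMascheroniConstant - 1) * (n * x) + n * (n + 1) / 4 + r₂) -
      (n * x * H - n * (n * (n + 1) / 2)) - divisorConvMain x| ≤ 100 * n := by
  have h0 : 0 < n := by linarith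
  obtain ⟨v, hv⟩ : ∃ v, v = x / n ^ 2 - 1 := ⟨_, rfl⟩
  have hxv : x = n ^ 2 * (1 + v) := by rw [hv]; field_simp; ring
  have hv0 : 0 ≤ v := by
    rw [hv, sub_nonneg, le_div_iff₀ (by positivity)]
    linarith
  have hnv : n * v ≤ 3 := by
    have : n * (n * v) ≤ n * 3 := by nlinarith
    exact le_of_mul_le_mul_left this h0
  have hv3 : v ≤ 3 := by nlinarith
  have hlog : log x = 2 * log n + log (1 + v) := by
    rw [hxv, log_mul (by positivity) (by positivity), log_pow]
    push_cast
    ring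
  have hL1 := one_add_mul_log_one_add_le hv0
  have hL2 := le_one_add_mul_log_one_add hv0
  obtain ⟨s, rfl⟩ : ∃ s, S = s + (π ^ 2 / 6 - 1 / n + 1 / (2 * n ^ 2)) :=
    ⟨_, (sub_add_cancel _ _).symm⟩
  obtain ⟨η, rfl⟩ : ∃ η, H = η + (log n + eulerMascheroniConstant + 1 / (2 * n)) :=
    ⟨_, (sub_add_cancel _ _).symm⟩
  obtain ⟨ν, rfl⟩ : ∃ ν, l = ν + (n * log n - n + 1 / 2 * log (2 * π) + 1 / 2 * log n) :=
    ⟨_, (sub_add_cancel _ _).symm⟩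
  rw [add_sub_cancel_right] at hS hH hl
  have hx4 : x ≤ 4 * n ^ 2 := by nlinarith
  have hx0 : 0 ≤ x := by nlinarith
  have e1 : |x ^ 2 / 2 * s| ≤ 8 * n := by
    rw [abs_mul, abs_of_nonneg (by positivity)]
    calc x ^ 2 / 2 * |s| ≤ (4 * n ^ 2) ^ 2 / 2 * (1 / n ^ 3) := by gcongr
      _ = 8 * n := by field_simp; norm_num
  have e2 : |(x / 2 + n * x) * η| ≤ 6 * n := by
    rw [abs_mul, abs_of_nonneg (by positivity)]
    calc (x / 2 + n * x) * |η| ≤ (4 * n ^ 2 / 2 + n * (4 * n ^ 2)) * (1 / n ^ 2) := by gcongr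
      _ = 2 + 4 * n := by field_simp; ring
      _ ≤ 6 * n := by linarith
  have e3 : |x * ν| ≤ 4 * n := by
    rw [abs_mul, abs_of_nonneg hx0]
    calc x * |ν| ≤ 4 * n ^ 2 * (1 / n) := by gcongr
      _ = 4 * n := by field_simp
  have key := hyperbola_combination_identity (n := n) (v := v) (s := s) (η := η) (ν := ν)
    (γ := eulerMascheroniConstant) (ln := log n) (lv := log (1 + v)) (c := log (2 * π))
    (p := π ^ 2) (r₁ := r₁) (r₂ := r₂) h0.ne'
  rw [← hlog, ← hxv] at key
  rw [divisorConvMain, key]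
  clear key
  have hnv0 : 0 ≤ n * v := by positivity
  have hnv3 : (n * v) ^ 3 ≤ 27 := by
    calc (n * v) ^ 3 ≤ 3 ^ 3 := by gcongr
      _ = 27 := by norm_num
  have hnv2 : (n * v) ^ 2 ≤ 9 := by nlinarith
  generalize hd : (1 + v) * log (1 + v) - v - v ^ 2 / 2 = d at *
  have hd0 : d ≤ 0 := by linarith
  have hd1 : n ^ 3 * d ≥ -(27 / 4) := by
    have : n ^ 3 * d ≥ n ^ 3 * (-(v ^ 3 / 4)) := by
      apply mul_le_mul_of_nonneg_left _ (by positivity)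
      linarith
    linarith [show n ^ 3 * (-(v ^ 3 / 4)) = -(n * v) ^ 3 / 4 by ring]
  have hd2 : n ^ 3 * d ≤ 0 := mul_nonpos_of_nonneg_of_nonpos (by positivity) hd0
  have hd3 : n ^ 2 / 2 * d ≤ 0 := mul_nonpos_of_nonneg_of_nonpos (by positivity) hd0
  have hd4 : n ^ 2 / 2 * d ≥ n ^ 3 * d := by
    apply mul_le_mul_of_nonpos_right _ hd0
    have h1 : n ^ 2 * 1 ≤ n ^ 2 * n := by gcongr
    have h2 : 0 ≤ n ^ 2 := by positivity
    linarith [show n ^ 2 * n = n ^ 3 by ring]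
  obtain ⟨e1', e1''⟩ := abs_le.1 e1
  obtain ⟨e2', e2''⟩ := abs_le.1 e2
  obtain ⟨e3', e3''⟩ := abs_le.1 e3
  obtain ⟨r1', r1''⟩ := abs_le.1 hr₁
  obtain ⟨r2', r2''⟩ := abs_le.1 hr₂
  have hnv4 := sq_nonneg (n * v)
  clear hx hx' hv hxv hlog hL1 hL2 hd hS hH hl hx4 hx0 e1 e2 e3 hr₁ hr₂
  rw [abs_le]
  constructor <;> linarith

lemma abs_divisorConvSum_sub_main_le {x : ℝ} (hx : 1 ≤ x) :
    |divisorConvSum x - divisorConvMain x| ≤ 100 * √x := by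
  have hx0 : 0 < x := by linarith
  set N := ⌊x⌋₊ with hN
  have hN1 : 1 ≤ N := (Nat.one_le_floor_iff x).2 hx
  set n := N.sqrt with hn
  have hn1 : 1 ≤ n := Nat.le_sqrt.2 (by omega)
  have hNx : (N : ℝ) ≤ x := Nat.floor_le hx0.le
  have hxN := Nat.lt_floor_add_one x
  have hnx : (n : ℝ) ^ 2 ≤ x := by
    refine le_trans ?_ hNx
    exact_mod_cast Nat.sqrt_le' N
  have hxn : x < ((n : ℝ) + 1) ^ 2 := by
    refine hxN.trans_le ?_
    exact_mod_cast Nat.lt_succ_sqrt' N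
  have hnR : (1 : ℝ) ≤ n := by exact_mod_cast hn1
  have fl : ∀ j : ℕ, N / j = ⌊x / j⌋₊ := fun j => (Nat.floor_div_natCast x j).symm
  have pos : ∀ j ∈ Finset.Ioc 0 n, (0 : ℝ) < j ∧ (j : ℝ) ≤ n := fun j hj =>
    ⟨by exact_mod_cast (Finset.mem_Ioc.1 hj).1, by exact_mod_cast (Finset.mem_Ioc.1 hj).2⟩
  have h1 : |∑ f ∈ Finset.Ioc 0 n, ∑ j ∈ Finset.Ioc 0 (N / f), (x / f - (j : ℝ)) -
      ∑ f ∈ Finset.Ioc 0 n, ((x / f) ^ 2 / 2 - x / f / 2)| ≤ n * 1 := by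
    have := abs_sum_sub_sum_le (s := Finset.Ioc 0 n) (c := 1)
      (a := fun f => ∑ j ∈ Finset.Ioc 0 (N / f), (x / f - (j : ℝ)))
      (b := fun f => (x / f) ^ 2 / 2 - x / f / 2) fun f hf => by
        rw [fl]
        exact (abs_sum_sub_floor_le (by positivity)).trans (by norm_num)
    simpa using this
  have h2 : |∑ j ∈ Finset.Ioc 0 n, ∑ f ∈ Finset.Ioc 0 (N / j), (x / f - (j : ℝ)) -
      ∑ j ∈ Finset.Ioc 0 n, (x * log x - x * log j + (eulerMascheroniConstant - 1) * x + j / 2)| ≤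
      n * 9 := by
    have := abs_sum_sub_sum_le (s := Finset.Ioc 0 n) (c := 9)
      (a := fun j => ∑ f ∈ Finset.Ioc 0 (N / j), (x / f - (j : ℝ)))
      (b := fun j => x * log x - x * log j + (eulerMascheroniConstant - 1) * x + j / 2)
      fun j hj => by
        obtain ⟨hj0, hjn⟩ := pos j hj
        have hy : 1 ≤ x / j := by
          rw [le_div_iff₀ hj0]
          nlinarith
        have hb := abs_mul_harmonic_floor_sub_le hy
        have e : ∑ f ∈ Finset.Ioc 0 (N / j), (x / f - (j : ℝ)) =
            j * (x / j * harmonic ⌊x / j⌋₊ - ⌊x / j⌋₊) := by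
          rw [Finset.sum_sub_distrib, fl, ← sum_Ioc_harmonic]
          simp only [Finset.sum_const, Nat.card_Ioc, nsmul_eq_mul, mul_sub, Finset.mul_sum]
          congr 1
          · refine Finset.sum_congr rfl fun f _ => ?_
            field_simp
          · simp [mul_comm]
        have e' : ∑ f ∈ Finset.Ioc 0 (N / j), (x / f - (j : ℝ)) -
            (x * log x - x * log j + (eulerMascheroniConstant - 1) * x + j / 2) =
            j * (x / j * harmonic ⌊x / j⌋₊ - ⌊x / j⌋₊ -
              (x / j * log (x / j) + eulerMascheroniConstant * (x / j) - x / j + 1 / 2)) := by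
          rw [e, log_div hx0.ne' hj0.ne']
          field_simp
          ring
        rw [e', abs_mul, abs_of_pos hj0]
        calc (j : ℝ) * _ ≤ j * (9 / (x / j)) := by gcongr
          _ = 9 * (j ^ 2 / x) := by field_simp
          _ ≤ 9 * 1 := by
            gcongr
            rw [div_le_one hx0]
            nlinarith
          _ = 9 := by norm_num
    simpa using this
  set R₁ := ∑ f ∈ Finset.Ioc 0 n, ∑ j ∈ Finset.Ioc 0 (N / f), (x / f - (j : ℝ)) with hR₁
  set R₂ := ∑ j ∈ Finset.Ioc 0 n, ∑ f ∈ Finset.Ioc 0 (N / j), (x / f - (j : ℝ)) with hR₂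
  have s1 : ∑ f ∈ Finset.Ioc 0 n, ((x / f) ^ 2 / 2 - x / f / 2) =
      x ^ 2 / 2 * ∑ f ∈ Finset.Ioc 0 n, 1 / (f : ℝ) ^ 2 - x / 2 * harmonic n := by
    rw [← sum_Ioc_harmonic, Finset.mul_sum, Finset.mul_sum, ← Finset.sum_sub_distrib]
    refine Finset.sum_congr rfl fun f _ => ?_
    ring
  have s2 : ∑ j ∈ Finset.Ioc 0 n,
      (x * log x - x * log j + (eulerMascheroniConstant - 1) * x + (j : ℝ) / 2) =
      n * (x * log x) - x * log n.factorial + (eulerMascheroniConstant - 1) * (n * x) +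
        n * (n + 1) / 4 := by
    rw [Finset.sum_add_distrib, Finset.sum_add_distrib, Finset.sum_sub_distrib,
      ← Finset.mul_sum (f := fun j : ℕ => log (j : ℝ)), sum_Ioc_log, ← Finset.sum_div, sum_Ioc_natCast]
    simp only [Finset.sum_const, Nat.card_Ioc, nsmul_eq_mul, Nat.sub_zero]
    ring
  have s3 : ∑ f ∈ Finset.Ioc 0 n, ∑ j ∈ Finset.Ioc 0 n, (x / f - (j : ℝ)) =
      n * x * harmonic n - n * (n * (n + 1) / 2) := by
    simp only [Finset.sum_sub_distrib, sum_Ioc_natCast, Finset.sum_const, Nat.card_Ioc,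
      nsmul_eq_mul, Nat.sub_zero]
    rw [← sum_Ioc_harmonic, Finset.mul_sum]
    congr 1
    refine Finset.sum_congr rfl fun f _ => ?_
    ring
  rw [s1] at h1
  rw [s2] at h2
  have := abs_hyperbola_combination_sub_main_le hnR hnx hxn (abs_sum_inv_sq_sub_le hn1)
    (abs_harmonic_sub_le hn1) (abs_log_factorial_sub_le hn1) (h1.trans_eq (mul_one _))
    (h2.trans_eq (mul_comm _ _))
  have hQ : divisorConvSum x = R₁ + R₂ - (n * x * harmonic n - n * (n * (n + 1) / 2)) := by
    rw [divisorConvSum, ← hN, sum_Ioc_hyperbola (fun f j => x / f - (j : ℝ)), s3]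
  rw [hQ]
  refine le_trans (le_of_eq ?_) (this.trans ?_)
  · congr 1
    ring
  · gcongr
    exact le_sqrt_of_sq_le hnx

/-- Values at the powers of a prime `p` of the multiplicative function `correction`. -/
noncomputable def correctionLocal (p : ℕ) : ℕ → ℝ
  | 0 => 1
  | 1 => if p = 2 then -1 / 2 else 2 / (p * (p - 2))
  | 2 => if p = 2 then 0 else -1 / (p * (p - 2))
  | _ + 3 => 0

/-- The multiplicative function `g` for which `𝔖(2 * m)` is a constant multiple of `(g * σ₋₁)(m)`. -/
noncomputable def correction : ArithmeticFunction ℝ where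
  toFun n := if n = 0 then 0 else n.factorization.prod correctionLocal
  map_zero' := if_pos rfl

lemma correction_apply {n : ℕ} (hn : n ≠ 0) :
    correction n = n.factorization.prod correctionLocal := if_neg hn

lemma isMultiplicative_correction : correction.IsMultiplicative := by
  refine ArithmeticFunction.IsMultiplicative.iff_ne_zero.2 ⟨?_, fun {m n} hm hn hmn => ?_⟩
  · simp [correction_apply]
  · rw [correction_apply (mul_ne_zero hm hn), correction_apply hm, correction_apply hn,
      Nat.factorization_mul_of_coprime hmn,
      Finsupp.prod_add_index_of_disjoint (by simpa using hmn.disjoint_primeFactors)]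

lemma correction_prime_pow {p : ℕ} (hp : p.Prime) (k : ℕ) :
    correction (p ^ k) = correctionLocal p k := by
  rw [correction_apply (pow_ne_zero _ hp.ne_zero), hp.factorization_pow]
  exact Finsupp.prod_single_index rfl

/-- The arithmetic function `n ↦ 1 / n`. -/
noncomputable def recip : ArithmeticFunction ℝ where
  toFun n := 1 / n
  map_zero' := by simp

lemma recip_apply (n : ℕ) : recip n = 1 / (n : ℝ) := rfl

lemma isMultiplicative_recip : recip.IsMultiplicative := by
  refine ⟨by simp [recip_apply], fun {m n} _ => ?_⟩
  simp only [recip_apply, Nat.cast_mul]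
  ring

/-- The function `m ↦ ∏_{p ∣ m, p > 2} (p - 1) / (p - 2)`. -/
noncomputable def oddLocalProduct : ArithmeticFunction ℝ :=
  ArithmeticFunction.prodPrimeFactors fun p => if 2 < p then ((p : ℝ) - 1) / (p - 2) else 1

lemma isMultiplicative_oddLocalProduct : oddLocalProduct.IsMultiplicative :=
  ArithmeticFunction.IsMultiplicative.prodPrimeFactors _

lemma mul_apply_prime_pow (f g : ArithmeticFunction ℝ) {p : ℕ} (hp : p.Prime) (k : ℕ) :
    (f * g) (p ^ k) = ∑ i ∈ Finset.range (k + 1), f (p ^ i) * g (p ^ (k - i)) := by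
  rw [ArithmeticFunction.mul_apply, Nat.sum_divisorsAntidiagonal (fun a b => f a * g b),
    Nat.sum_divisors_prime_pow hp]
  refine Finset.sum_congr rfl fun i hi => ?_
  rw [Nat.pow_div (by simpa [Nat.lt_succ_iff] using hi) hp.pos]

lemma recip_mul_zeta_prime_pow_succ {p : ℕ} (hp : p.Prime) (k : ℕ) :
    (recip * (ArithmeticFunction.zeta : ArithmeticFunction ℝ)) (p ^ (k + 1)) =
      1 + 1 / p * (recip * (ArithmeticFunction.zeta : ArithmeticFunction ℝ)) (p ^ k) := by
  have hz : ∀ j, (ArithmeticFunction.zeta : ArithmeticFunction ℝ) (p ^ j) = 1 := fun j => by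
    simp [hp.ne_zero]
  simp only [mul_apply_prime_pow _ _ hp, hz, mul_one, recip_apply]
  rw [Finset.sum_range_succ', Finset.mul_sum, add_comm]
  congr 1
  · simp
  · refine Finset.sum_congr rfl fun i _ => ?_
    push_cast
    rw [pow_succ]
    ring

lemma recip_mul_zeta_prime_pow_zero (p : ℕ) :
    (recip * (ArithmeticFunction.zeta : ArithmeticFunction ℝ)) (p ^ 0) = 1 := by
  simp [recip_apply]

lemma two_lt_of_prime_ne {p : ℕ} (hp : p.Prime) (h2 : p ≠ 2) : (2 : ℝ) < p := by
  have := hp.two_le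
  exact_mod_cast lt_of_le_of_ne this h2.symm

lemma correction_mul_eq_oddLocalProduct :
    correction * (recip * (ArithmeticFunction.zeta : ArithmeticFunction ℝ)) = oddLocalProduct := by
  refine (ArithmeticFunction.IsMultiplicative.eq_iff_eq_on_prime_powers _
    (isMultiplicative_correction.mul (isMultiplicative_recip.mul
      ArithmeticFunction.isMultiplicative_zeta.natCast)) _
    isMultiplicative_oddLocalProduct).2 fun p k hp => ?_
  have hR : ∀ k ≠ 0, oddLocalProduct (p ^ k) = if 2 < p then ((p : ℝ) - 1) / (p - 2) else 1 := by
    intro k hk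
    rw [oddLocalProduct, ArithmeticFunction.prodPrimeFactors_apply (pow_ne_zero _ hp.ne_zero),
      Nat.primeFactors_prime_pow hk hp, Finset.prod_singleton]
  have hp0 : (p : ℝ) ≠ 0 := by exact_mod_cast hp.ne_zero
  have h2 : ∀ h : p ≠ 2, (p : ℝ) - 2 ≠ 0 := fun h => by
    have := two_lt_of_prime_ne hp h
    linarith
  rw [mul_apply_prime_pow _ _ hp]
  simp only [correction_prime_pow hp]
  match k with
  | 0 => simp [correctionLocal, oddLocalProduct, recip_apply]
  | 1 =>
    rw [hR 1 one_ne_zero, Finset.sum_range_succ, Finset.sum_range_one]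
    simp only [Nat.sub_zero, Nat.sub_self, correctionLocal]
    rw [← zero_add 1, recip_mul_zeta_prime_pow_succ hp, recip_mul_zeta_prime_pow_zero]
    by_cases h : p = 2
    · subst h
      norm_num
    · have h' : 2 < p := by exact_mod_cast two_lt_of_prime_ne hp h
      have := h2 h
      simp only [h, h', if_true, if_false]
      field_simp
      ring
  | k + 2 =>
    rw [hR (k + 2) (by omega), Finset.sum_range_succ', Finset.sum_range_succ', Finset.sum_range_succ']
    rw [Finset.sum_eq_zero fun i _ => by simp [correctionLocal]]
    simp only [correctionLocal, zero_add]
    rw [show k + 2 - 0 = k + 1 + 1 by omega, show k + 2 - 1 = k + 1 by omega,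
      show k + 2 - (1 + 1) = k by omega, recip_mul_zeta_prime_pow_succ hp (k + 1),
      recip_mul_zeta_prime_pow_succ hp k]
    generalize (recip * (ArithmeticFunction.zeta : ArithmeticFunction ℝ)) (p ^ k) = σ
    by_cases h : p = 2
    · subst h
      norm_num
    · have h' : 2 < p := by exact_mod_cast two_lt_of_prime_ne hp h
      have := h2 h
      simp only [h, h', if_true, if_false]
      field_simp
      ring

/-- The constant `∏_{p > 2} (1 - 1 / (p - 1)²)`. -/
noncomputable def twinConst : ℝ :=
  ∏' p : Nat.Primes, if 2 < (p : ℕ) then (1 - 1 / ((p : ℝ) - 1) ^ 2) else 1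

lemma singularSeries_two_mul {m : ℕ} (hm : m ≠ 0) :
    singularSeries (2 * m) = 2 * twinConst * oddLocalProduct m := by
  rw [singularSeries, if_pos (even_two_mul m), twinConst, oddLocalProduct,
    ArithmeticFunction.prodPrimeFactors_apply hm, ← Finset.prod_filter,
    Nat.primeFactors_mul two_ne_zero hm, Nat.prime_two.primeFactors, Finset.filter_union]
  simp [Finset.filter_singleton]

lemma sum_weight_mul_convolution (f g : ArithmeticFunction ℝ) (w : ℕ → ℝ) (N : ℕ) :
    ∑ n ∈ Finset.Ioc 0 N, w n * (f * g) n =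
      ∑ a ∈ Finset.Ioc 0 N, f a * ∑ b ∈ Finset.Ioc 0 (N / a), w (a * b) * g b := by
  have h : ∀ n ∈ Finset.Ioc 0 N, w n * (f * g) n =
      ∑ a ∈ Finset.Ioc 0 N, ∑ b ∈ Finset.Ioc 0 N,
        if a * b = n then w (a * b) * (f a * g b) else 0 := by
    intro n hn
    rw [Finset.mem_Ioc] at hn
    rw [ArithmeticFunction.mul_apply,
      Nat.divisorsAntidiagonal_eq_prod_filter_of_le hn.1.ne' hn.2, Finset.mul_sum,
      Finset.sum_filter, Finset.sum_product]
    refine Finset.sum_congr rfl fun a _ => Finset.sum_congr rfl fun b _ => ?_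
    split_ifs with h
    · rw [h]
    · rfl
  rw [Finset.sum_congr rfl h, Finset.sum_comm]
  refine Finset.sum_congr rfl fun a ha => ?_
  rw [Finset.mem_Ioc] at ha
  rw [Finset.sum_comm, Finset.mul_sum]
  have h2 : ∀ b ∈ Finset.Ioc 0 N, (∑ n ∈ Finset.Ioc 0 N,
      if a * b = n then w (a * b) * (f a * g b) else 0) =
      if a * b ≤ N then f a * (w (a * b) * g b) else 0 := by
    intro b hb
    rw [Finset.mem_Ioc] at hb
    rw [Finset.sum_ite_eq]
    have : 0 < a * b := Nat.mul_pos ha.1 hb.1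
    simp only [Finset.mem_Ioc, this, true_and]
    split_ifs <;> ring
  rw [Finset.sum_congr rfl h2, ← Finset.sum_filter]
  refine Finset.sum_congr ?_ fun _ _ => rfl
  ext b
  simp only [Finset.mem_Ioc, Finset.mem_filter, Nat.le_div_iff_mul_le ha.1, mul_comm b a]
  constructor
  · rintro ⟨⟨h1, _⟩, h2⟩
    exact ⟨h1, h2⟩
  · rintro ⟨h1, h2⟩
    exact ⟨⟨h1, (Nat.le_mul_of_pos_left b ha.1).trans h2⟩, h2⟩

lemma sum_weight_oddLocalProduct (x : ℝ) :
    ∑ m ∈ Finset.Ioc 0 ⌊x⌋₊, (x - m) * oddLocalProduct m =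
      ∑ e ∈ Finset.Ioc 0 ⌊x⌋₊, correction e * e * divisorConvSum (x / e) := by
  rw [← correction_mul_eq_oddLocalProduct, sum_weight_mul_convolution _ _ (fun m => x - m)]
  refine Finset.sum_congr rfl fun e he => ?_
  have he0 : (e : ℝ) ≠ 0 := by exact_mod_cast (Finset.mem_Ioc.1 he).1.ne'
  rw [sum_weight_mul_convolution _ _ (fun b => x - ((e * b : ℕ) : ℝ)), mul_assoc, divisorConvSum,
    Nat.floor_div_natCast]
  congr 1
  rw [Finset.mul_sum]
  refine Finset.sum_congr rfl fun f hf => ?_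
  have hf0 : (f : ℝ) ≠ 0 := by exact_mod_cast (Finset.mem_Ioc.1 hf).1.ne'
  rw [Finset.mul_sum, Finset.mul_sum]
  refine Finset.sum_congr rfl fun j hj => ?_
  have hj0 : j ≠ 0 := (Finset.mem_Ioc.1 hj).1.ne'
  simp only [ArithmeticFunction.natCoe_apply, ArithmeticFunction.zeta_apply_ne hj0, recip_apply]
  push_cast
  field_simp

lemma sum_singularSeries_eq (h : ℕ) :
    ∑ k ∈ Finset.Icc 1 h, ((h : ℝ) - (k : ℝ)) * singularSeries k =
      4 * twinConst * ∑ e ∈ Finset.Ioc 0 ⌊(h : ℝ) / 2⌋₊,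
        correction e * e * divisorConvSum ((h : ℝ) / 2 / e) := by
  rw [← sum_weight_oddLocalProduct, Finset.mul_sum]
  have hfl : ⌊(h : ℝ) / 2⌋₊ = h / 2 := by
    have := Nat.floor_div_natCast (h : ℝ) 2
    simpa using this
  rw [hfl]
  symm
  apply Finset.sum_of_injOn (fun m : ℕ => 2 * m)
  · intro a _ b _ hab
    simpa using hab
  · intro m hm
    simp only [Finset.coe_Ioc, Set.mem_Ioc, Finset.coe_Icc, Set.mem_Icc] at hm ⊢
    omega
  · intro k hk hk'
    have hodd : ¬ Even k := by
      rintro ⟨m, rfl⟩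
      apply hk'
      simp only [Finset.coe_Ioc, Set.mem_image, Set.mem_Ioc, Finset.mem_Icc] at hk ⊢
      exact ⟨m, by omega, by omega⟩
    rw [singularSeries, if_neg hodd, mul_zero]
  · intro m hm
    rw [singularSeries_two_mul (Finset.mem_Ioc.1 hm).1.ne']
    push_cast
    ring

lemma exists_abs_divisorConvSum_sub_main_le {s : ℝ} (hs : 1 / 2 ≤ s) (hs1 : s < 1) :
    ∃ K : ℝ, 0 ≤ K ∧ ∀ x : ℝ, 0 < x →
      |divisorConvSum x - divisorConvMain x| ≤ K * x ^ s := by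
  obtain ⟨a, ha⟩ : ∃ a : ℝ, a = 1 / 2 * (1 - eulerMascheroniConstant - log (2 * π)) := ⟨_, rfl⟩
  have h1s : 0 < 1 - s := by linarith
  have hB : 0 ≤ π ^ 2 / 12 + 1 / 2 * (1 / (1 - s)) + |a| := by positivity
  refine ⟨100 + (π ^ 2 / 12 + 1 / 2 * (1 / (1 - s)) + |a|), by positivity, fun x hx => ?_⟩
  have hxs : 0 < x ^ s := rpow_pos_of_pos hx s
  rcases le_or_gt 1 x with h | h
  · refine (abs_divisorConvSum_sub_main_le h).trans ?_
    have h1 : √x ≤ x ^ s := by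
      rw [sqrt_eq_rpow]
      exact rpow_le_rpow_of_exponent_le h hs
    have := mul_nonneg hB hxs.le
    linarith
  · have h0 : divisorConvSum x = 0 := by simp [divisorConvSum, Nat.floor_eq_zero.2 h]
    have e1 : x ≤ x ^ s := by
      have := rpow_le_rpow_of_exponent_ge hx h.le hs1.le
      rwa [rpow_one] at this
    have e2 : x ^ 2 ≤ x ^ s := by nlinarith
    have e3 : |x * log x| ≤ 1 / (1 - s) * x ^ s := by
      have h3 := (abs_log_mul_self_rpow_lt x (1 - s) hx h.le h1s).le
      have : x * log x = (log x * x ^ (1 - s)) * x ^ s := by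
        rw [mul_assoc, ← rpow_add hx, sub_add_cancel, rpow_one, mul_comm]
      rw [this, abs_mul, abs_of_pos hxs]
      gcongr
    have e4 : |a * x| ≤ |a| * x ^ s := by
      rw [abs_mul, abs_of_pos hx]
      gcongr
    rw [h0, divisorConvMain, ← ha]
    have f1 := abs_le.1 e3
    have f2 := abs_le.1 e4
    obtain ⟨f11, f12⟩ := f1
    obtain ⟨f21, f22⟩ := f2
    have f3 : π ^ 2 / 12 * x ^ 2 ≤ π ^ 2 / 12 * x ^ s := by gcongr
    have f4 : 0 ≤ π ^ 2 / 12 * x ^ 2 := by positivity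
    rw [abs_le]
    constructor <;> nlinarith

lemma summable_of_tsum_prime_pow_le {f : ℕ → ℝ} (h0 : f 0 = 0) (h1 : f 1 = 1)
    (hmul : ∀ {m n}, Nat.Coprime m n → f (m * n) = f m * f n) (hf : ∀ n, 0 ≤ f n) {u : ℕ → ℝ}
    (hu0 : ∀ n, 0 ≤ u n) (hu : Summable u) (hs : ∀ p, p.Prime → Summable fun n => f (p ^ n))
    (hle : ∀ p, p.Prime → ∑' n, f (p ^ n) ≤ 1 + u p) : Summable f := by
  refine summable_of_sum_le hf (c := exp (∑' n, u n)) fun S => ?_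
  obtain ⟨N, hN⟩ := S.exists_nat_subset_range
  obtain ⟨hsm, hsum⟩ := EulerProduct.summable_and_hasSum_smoothNumbers_prod_primesBelow_tsum h1
    hmul (fun {p} hp => by simpa only [norm_of_nonneg (hf _)] using hs p hp) N
  have hS : ∑ n ∈ S, f n ≤ ∑' m : N.smoothNumbers, f m := by
    have h2 : ∑' m : N.smoothNumbers, f m = ∑' m, (N.smoothNumbers).indicator f m :=
      tsum_subtype _ _
    have h3 : Summable ((N.smoothNumbers).indicator f) :=
      summable_subtype_iff_indicator.1 hsum.summable
    rw [h2]
    refine le_trans (Finset.sum_le_sum fun n hn => ?_)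
      (h3.sum_le_tsum S fun n _ => Set.indicator_nonneg (fun _ _ => hf _) _)
    rcases eq_or_ne n 0 with rfl | hn0
    · simp [h0, Set.indicator_apply]
    · rw [Set.indicator_of_mem]
      exact Nat.mem_smoothNumbers_of_lt (Nat.pos_of_ne_zero hn0) (Finset.mem_range.1 (hN hn))
  rw [hsum.tsum_eq] at hS
  refine hS.trans ?_
  calc ∏ p ∈ N.primesBelow, ∑' n, f (p ^ n)
      ≤ ∏ p ∈ N.primesBelow, exp (u p) := by
        refine Finset.prod_le_prod (fun p _ => tsum_nonneg fun _ => hf _) fun p hp => ?_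
        have := hle p (Nat.prime_of_mem_primesBelow hp)
        have := add_one_le_exp (u p)
        linarith
    _ = exp (∑ p ∈ N.primesBelow, u p) := (exp_sum _ _).symm
    _ ≤ exp (∑' n, u n) := exp_le_exp.2 (hu.sum_le_tsum _ fun n _ => hu0 n)

lemma hasSum_of_eq_zero_of_three_le {R : Type*} [AddCommMonoid R] [TopologicalSpace R]
    {f : ℕ → R} (hf : ∀ k, f (k + 3) = 0) : HasSum f (f 0 + f 1 + f 2) := by
  have h : HasSum f (∑ k ∈ Finset.range 3, f k) := hasSum_sum_of_ne_finset_zero fun b hb => by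
    obtain ⟨k, rfl⟩ : ∃ k, b = k + 3 := ⟨b - 3, by simp at hb; omega⟩
    exact hf k
  simpa [Finset.sum_range_succ] using h

lemma abs_correctionLocal_one_le {p : ℕ} (hp : p.Prime) :
    |correctionLocal p 1| ≤ 6 / (p : ℝ) ^ 2 := by
  by_cases h : p = 2
  · subst h
    norm_num [correctionLocal, abs_of_neg]
  · have h3 : (3 : ℝ) ≤ p := by
      have : 2 < p := by exact_mod_cast two_lt_of_prime_ne hp h
      exact_mod_cast this
    have h2 : (0 : ℝ) < p - 2 := by linarith
    simp only [correctionLocal, h, if_false]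
    rw [abs_of_nonneg (by positivity), div_le_div_iff₀ (by positivity) (by positivity)]
    nlinarith

lemma abs_correctionLocal_two_le {p : ℕ} (hp : p.Prime) :
    |correctionLocal p 2| ≤ 3 / (p : ℝ) ^ 2 := by
  by_cases h : p = 2
  · subst h
    norm_num [correctionLocal]
  · have h3 : (3 : ℝ) ≤ p := by
      have : 2 < p := by exact_mod_cast two_lt_of_prime_ne hp h
      exact_mod_cast this
    have h2 : (0 : ℝ) < p - 2 := by linarith
    simp only [correctionLocal, h, if_false]
    rw [neg_div, abs_neg, abs_of_nonneg (by positivity),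
      div_le_div_iff₀ (by positivity) (by positivity)]
    nlinarith

lemma summable_abs_correction_mul_rpow {t : ℝ} (ht : 0 ≤ t) (ht2 : t < 1 / 2) :
    Summable fun n : ℕ => |correction n| * (n : ℝ) ^ t := by
  have hz : ∀ p : ℕ, p.Prime → ∀ k, |correction (p ^ (k + 3))| * ((p ^ (k + 3) : ℕ) : ℝ) ^ t = 0 :=
    fun p hp k => by
      rw [correction_prime_pow hp, correctionLocal, abs_zero, zero_mul]
  refine summable_of_tsum_prime_pow_le (u := fun n => 9 * (n : ℝ) ^ (2 * t - 2)) (by simp)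
    (by simp [isMultiplicative_correction.map_one]) (fun {m n} hmn => ?_) (fun n => by positivity)
    (fun n => by positivity) ((summable_nat_rpow.2 (by linarith)).mul_left 9)
    (fun p hp => (hasSum_of_eq_zero_of_three_le (hz p hp)).summable) fun p hp => ?_
  · rw [isMultiplicative_correction.map_mul_of_coprime hmn, abs_mul, Nat.cast_mul,
      mul_rpow (Nat.cast_nonneg _) (Nat.cast_nonneg _)]
    ring
  · rw [(hasSum_of_eq_zero_of_three_le (hz p hp)).tsum_eq]
    simp only [correction_prime_pow hp]
    have hp0 : (0 : ℝ) < p := by exact_mod_cast hp.pos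
    have hp1 : (1 : ℝ) ≤ p := by exact_mod_cast hp.one_le
    have e1 : (p : ℝ) ^ (2 * t - 2) = (p : ℝ) ^ (2 * t) / (p : ℝ) ^ 2 := by
      rw [rpow_sub hp0, rpow_two]
    have e2 : (((p ^ 2 : ℕ) : ℝ)) ^ t = (p : ℝ) ^ (2 * t) := by
      rw [rpow_mul hp0.le, Nat.cast_pow, rpow_two]
    have e3 : (((p ^ 1 : ℕ) : ℝ)) ^ t ≤ (p : ℝ) ^ (2 * t) := by
      rw [pow_one]
      exact rpow_le_rpow_of_exponent_le hp1 (by linarith)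
    have e4 : |correctionLocal p 1| * ((p ^ 1 : ℕ) : ℝ) ^ t ≤
        6 / (p : ℝ) ^ 2 * (p : ℝ) ^ (2 * t) :=
      mul_le_mul (abs_correctionLocal_one_le hp) e3 (by positivity) (by positivity)
    have e5 : |correctionLocal p 2| * ((p ^ 2 : ℕ) : ℝ) ^ t ≤
        3 / (p : ℝ) ^ 2 * (p : ℝ) ^ (2 * t) := by
      rw [e2]
      exact mul_le_mul_of_nonneg_right (abs_correctionLocal_two_le hp) (by positivity)
    have e0 : |correctionLocal p 0| * ((p ^ 0 : ℕ) : ℝ) ^ t = 1 := by simp [correctionLocal]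
    rw [e0, e1]
    calc _ ≤ 1 + 6 / (p : ℝ) ^ 2 * (p : ℝ) ^ (2 * t) + 3 / (p : ℝ) ^ 2 * (p : ℝ) ^ (2 * t) := by
          linarith
      _ = _ := by ring

lemma multipliable_twinConst :
    Multipliable fun p : Nat.Primes =>
      if 2 < (p : ℕ) then (1 - 1 / ((p : ℝ) - 1) ^ 2) else 1 := by
  have h : Summable fun p : Nat.Primes =>
      if 2 < (p : ℕ) then -(1 / ((p : ℝ) - 1) ^ 2) else 0 := by
    refine Summable.of_norm_bounded (g := fun p : Nat.Primes => 4 * (1 / ((p : ℕ) : ℝ) ^ 2))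
      (((summable_one_div_nat_pow.2 one_lt_two).subtype _).mul_left 4) fun p => ?_
    have hp : (2 : ℝ) ≤ (p : ℕ) := by exact_mod_cast p.2.two_le
    split_ifs
    · rw [norm_neg, norm_of_nonneg (by positivity), mul_one_div,
        div_le_div_iff₀ (by nlinarith) (by positivity)]
      nlinarith
    · rw [norm_zero]
      positivity
  refine (multipliable_one_add_of_summable h.norm).congr fun p => ?_
  split_ifs <;> ring

lemma hasProd_twinConst :
    HasProd (fun p : Nat.Primes =>
      if 2 < (p : ℕ) then (1 - 1 / ((p : ℝ) - 1) ^ 2) else 1) twinConst :=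
  multipliable_twinConst.hasProd

lemma summable_abs_correction : Summable fun n : ℕ => |correction n| := by
  simpa using summable_abs_correction_mul_rpow le_rfl one_half_pos

lemma tsum_correction_mul_twinConst : (∑' n, correction n) * twinConst = 1 / 2 := by
  have h1 := (isMultiplicative_correction.eulerProduct_hasProd
    summable_abs_correction).mul hasProd_twinConst
  have h2 : HasProd (fun p : Nat.Primes => if (p : ℕ) = 2 then (1 / 2 : ℝ) else 1) (1 / 2) := by
    have h3 := hasProd_single (f := fun p : Nat.Primes => if (p : ℕ) = 2 then (1 / 2 : ℝ) else 1)
      ⟨2, Nat.prime_two⟩ fun p hp => if_neg fun h => hp (Subtype.ext h)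
    simpa only [if_true] using h3
  refine (h1.congr_fun fun p => ?_).unique h2
  obtain ⟨p, hp⟩ := p
  have hz : ∀ k, correction (p ^ (k + 3)) = 0 := fun k => by
    rw [correction_prime_pow hp, correctionLocal]
  have hsum := (hasSum_of_eq_zero_of_three_le (f := fun k : ℕ => correction (p ^ k)) hz).tsum_eq
  simp only [hsum]
  simp only [correction_prime_pow hp, correctionLocal]
  by_cases h : p = 2
  · subst h
    norm_num
  · have h2 := two_lt_of_prime_ne hp h
    have h' : 2 < p := by exact_mod_cast h2
    simp only [h, h', if_true, if_false]
    have : (p : ℝ) - 2 ≠ 0 := by linarith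
    have : (p : ℝ) - 1 ≠ 0 := by linarith
    have : (p : ℝ) ≠ 0 := by linarith
    field_simp
    ring

lemma hasProd_recip_sq :
    HasProd (fun p : Nat.Primes => (1 - 1 / ((p : ℕ) : ℝ) ^ 2)⁻¹) (π ^ 2 / 6) := by
  have hs : Summable fun n : ℕ => ‖recip.pmul recip n‖ := by
    refine (summable_one_div_nat_pow.2 one_lt_two).congr fun n => ?_
    simp only [ArithmeticFunction.pmul_apply, recip_apply]
    rw [norm_of_nonneg (by positivity)]
    ring
  have h := (isMultiplicative_recip.pmul isMultiplicative_recip).eulerProduct_hasProd hs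
  have h2 : ∑' n, recip.pmul recip n = π ^ 2 / 6 := by
    rw [← hasSum_zeta_two.tsum_eq]
    refine tsum_congr fun n => ?_
    simp only [ArithmeticFunction.pmul_apply, recip_apply]
    ring
  rw [h2] at h
  refine h.congr_fun fun p => ?_
  have hp : (2 : ℝ) ≤ (p : ℕ) := by exact_mod_cast p.2.two_le
  rw [← tsum_geometric_of_lt_one (by positivity)]
  · refine tsum_congr fun n => ?_
    simp only [ArithmeticFunction.pmul_apply, recip_apply, Nat.cast_pow, one_div, inv_pow]
    rw [← mul_inv, ← pow_mul, mul_comm 2 n, pow_mul, sq]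
  · rw [div_lt_one (by positivity)]
    nlinarith

lemma summable_abs_correction_div : Summable fun n : ℕ => |correction n / n| := by
  refine Summable.of_nonneg_of_le (fun _ => abs_nonneg _) (fun n => ?_) summable_abs_correction
  rw [abs_div, Nat.abs_cast]
  rcases Nat.eq_zero_or_pos n with rfl | hn
  · simp
  · exact div_le_self (abs_nonneg _) (by exact_mod_cast hn)

lemma tsum_correction_div_mul_twinConst :
    (∑' n : ℕ, correction n / n) * (π ^ 2 / 6) * twinConst = 1 := by
  have hm := isMultiplicative_correction.pmul isMultiplicative_recip
  have happ : ∀ n : ℕ, correction.pmul recip n = correction n / n := fun n => by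
    rw [ArithmeticFunction.pmul_apply, recip_apply, mul_one_div]
  have h := (hm.eulerProduct_hasProd (by simpa only [happ, norm_eq_abs] using summable_abs_correction_div)).mul
    hasProd_recip_sq |>.mul hasProd_twinConst
  simp only [happ] at h
  refine (h.congr_fun fun p => ?_).unique hasProd_one
  obtain ⟨p, hp⟩ := p
  have hz : ∀ k, correction (p ^ (k + 3)) / ((p ^ (k + 3) : ℕ) : ℝ) = 0 := fun k => by
    rw [correction_prime_pow hp, correctionLocal, zero_div]
  have hsum := (hasSum_of_eq_zero_of_three_le
    (f := fun k : ℕ => correction (p ^ k) / ((p ^ k : ℕ) : ℝ)) hz).tsum_eq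
  simp only [hsum]
  simp only [correction_prime_pow hp, correctionLocal]
  by_cases h : p = 2
  · subst h
    norm_num
  · have h2 := two_lt_of_prime_ne hp h
    have h' : 2 < p := by exact_mod_cast h2
    simp only [h, h', if_true, if_false]
    have : (p : ℝ) - 2 ≠ 0 := by linarith
    have : (p : ℝ) - 1 ≠ 0 := by linarith
    have : (p : ℝ) ≠ 0 := by linarith
    have : (p : ℝ) ^ 2 - 1 ≠ 0 := by nlinarith
    push_cast
    field_simp
    ring

lemma summable_abs_correction_mul_log : Summable fun n : ℕ => |correction n * log n| := by
  refine Summable.of_nonneg_of_le (fun _ => abs_nonneg _) (fun n => ?_)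
    ((summable_abs_correction_mul_rpow (t := 1 / 4) (by norm_num) (by norm_num)).mul_left 4)
  rw [abs_mul, abs_of_nonneg (log_natCast_nonneg n)]
  have h := log_le_rpow_div (Nat.cast_nonneg (α := ℝ) n) (ε := 1 / 4) (by norm_num)
  have := mul_le_mul_of_nonneg_left h (abs_nonneg (correction n))
  linarith

/-- The values `g(n)` of `correction` together with `g(n) log n`, in the ring of dual numbers. -/
noncomputable def dualCorrection (n : ℕ) : TrivSqZeroExt ℝ ℝ :=
  TrivSqZeroExt.inl (correction n) + TrivSqZeroExt.inr (correction n * log n)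

lemma fst_dualCorrection (n : ℕ) : (dualCorrection n).fst = correction n := by
  simp [dualCorrection]

lemma snd_dualCorrection (n : ℕ) : (dualCorrection n).snd = correction n * log n := by
  simp [dualCorrection]

lemma dualCorrection_mul {m n : ℕ} (h : Nat.Coprime m n) :
    dualCorrection (m * n) = dualCorrection m * dualCorrection n := by
  have hg := isMultiplicative_correction.map_mul_of_coprime h
  ext
  · simp only [TrivSqZeroExt.fst_mul, fst_dualCorrection, hg]
  · simp only [TrivSqZeroExt.snd_mul, fst_dualCorrection, snd_dualCorrection, hg, smul_eq_mul,
      MulOpposite.smul_eq_mul_unop, MulOpposite.unop_op]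
    rcases eq_or_ne m 0 with rfl | hm
    · simp
    rcases eq_or_ne n 0 with rfl | hn
    · simp
    rw [Nat.cast_mul, log_mul (by exact_mod_cast hm) (by exact_mod_cast hn)]
    ring

lemma snd_tsum_dualCorrection_prime_pow {p : ℕ} (hp : p.Prime) :
    (∑' k, dualCorrection (p ^ k)).snd =
      if p = 2 then -log 2 * (∑' k, dualCorrection (p ^ k)).fst else 0 := by
  have hz : ∀ k, dualCorrection (p ^ (k + 3)) = 0 := fun k => by
    have : correction (p ^ (k + 3)) = 0 := by rw [correction_prime_pow hp, correctionLocal]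
    ext
    · rw [fst_dualCorrection, this, TrivSqZeroExt.fst_zero]
    · rw [snd_dualCorrection, this, zero_mul, TrivSqZeroExt.snd_zero]
  rw [(hasSum_of_eq_zero_of_three_le hz).tsum_eq]
  simp only [TrivSqZeroExt.snd_add, TrivSqZeroExt.fst_add, fst_dualCorrection, snd_dualCorrection,
    correction_prime_pow hp, correctionLocal, Nat.cast_pow, log_pow]
  by_cases h : p = 2
  · subst h
    norm_num
    ring
  · simp only [h, if_false]
    push_cast
    ring

lemma tsum_correction_mul_log :
    ∑' n : ℕ, correction n * log n = -log 2 * ∑' n, correction n := by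
  have hs : Summable fun n => ‖dualCorrection n‖ := by
    refine (summable_abs_correction.add summable_abs_correction_mul_log).congr fun n => ?_
    rw [TrivSqZeroExt.norm_def, fst_dualCorrection, snd_dualCorrection, norm_eq_abs, norm_eq_abs]
  have h1 : dualCorrection 1 = 1 := by
    ext
    · rw [fst_dualCorrection, isMultiplicative_correction.map_one, TrivSqZeroExt.fst_one]
    · rw [snd_dualCorrection, Nat.cast_one, log_one, mul_zero, TrivSqZeroExt.snd_one]
  have h0 : dualCorrection 0 = 0 := by
    ext
    · simp [fst_dualCorrection]
    · simp [snd_dualCorrection]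
  have hlim := EulerProduct.eulerProduct h1 dualCorrection_mul hs h0
  have hsum := hs.of_norm.hasSum
  have hfst := (TrivSqZeroExt.hasSum_fst ℝ hsum).tsum_eq
  have hsnd := (TrivSqZeroExt.hasSum_snd ℝ hsum).tsum_eq
  simp only [fst_dualCorrection] at hfst
  simp only [snd_dualCorrection] at hsnd
  rw [hfst, hsnd]
  refine tendsto_nhds_unique ((TrivSqZeroExt.continuous_snd.tendsto _).comp hlim)
    ((((TrivSqZeroExt.continuous_fst.tendsto _).comp hlim).const_mul (-log 2)).congr' ?_)
  filter_upwards [Filter.eventually_ge_atTop 3] with N hN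
  have h2 : 2 ∈ N.primesBelow := Nat.mem_primesBelow.2 ⟨by omega, Nat.prime_two⟩
  have hrest : (∏ p ∈ N.primesBelow.erase 2, ∑' k, dualCorrection (p ^ k)).snd = 0 := by
    refine Finset.prod_induction _ (fun z : TrivSqZeroExt ℝ ℝ => z.snd = 0) (fun a b ha hb => ?_)
      TrivSqZeroExt.snd_one fun p hp => ?_
    · rw [TrivSqZeroExt.snd_mul, ha, hb, smul_zero, smul_zero, add_zero]
    · obtain ⟨hp2, hp⟩ := Finset.mem_erase.1 hp
      rw [snd_tsum_dualCorrection_prime_pow (Nat.prime_of_mem_primesBelow hp), if_neg hp2]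
  have hloc := snd_tsum_dualCorrection_prime_pow Nat.prime_two
  rw [if_pos rfl] at hloc
  simp only [Function.comp_apply]
  rw [← Finset.mul_prod_erase _ _ h2, TrivSqZeroExt.snd_mul, TrivSqZeroExt.fst_mul, hrest, hloc]
  simp only [smul_eq_mul, MulOpposite.smul_eq_mul_unop, MulOpposite.unop_op]
  ring

lemma exists_abs_sum_correction_sub_le {s : ℝ} (hs : 1 / 2 < s) (hs1 : s < 1) :
    ∃ K : ℝ, 0 ≤ K ∧ ∀ x : ℝ, 0 < x →
      |(∑ e ∈ Finset.Ioc 0 ⌊x⌋₊, correction e * e * divisorConvSum (x / e)) -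
        (π ^ 2 / 12 * x ^ 2 * (∑' n : ℕ, correction n / n) +
          (1 / 2 * (1 - eulerMascheroniConstant - log (2 * π)) * x - x / 2 * log x -
            x / 2 * log 2) * ∑' n, correction n)| ≤ K * x ^ s := by
  obtain ⟨K, hK, hle⟩ := exists_abs_divisorConvSum_sub_main_le hs.le hs1
  have hsum := summable_abs_correction_mul_rpow (t := 1 - s) (by linarith) (by linarith)
  refine ⟨K * ∑' n : ℕ, |correction n| * (n : ℝ) ^ (1 - s),
    mul_nonneg hK (tsum_nonneg fun n => by positivity), fun x hx => ?_⟩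
  have hT : HasSum (fun e : ℕ => correction e * e * divisorConvSum (x / e))
      (∑ e ∈ Finset.Ioc 0 ⌊x⌋₊, correction e * e * divisorConvSum (x / e)) := by
    refine hasSum_sum_of_ne_finset_zero fun e he => ?_
    rcases Nat.eq_zero_or_pos e with rfl | he0
    · simp
    · have h1 : ⌊x⌋₊ < e := by
        by_contra! h
        exact he (Finset.mem_Ioc.2 ⟨he0, h⟩)
      have h2 : ⌊x / e⌋₊ = 0 := by
        rw [Nat.floor_div_natCast, Nat.div_eq_of_lt h1]
      simp [divisorConvSum, h2]
  have h1 := summable_abs_correction.of_abs.hasSum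
  have h2 := summable_abs_correction_div.of_abs.hasSum
  have h3 := summable_abs_correction_mul_log.of_abs.hasSum
  rw [tsum_correction_mul_log] at h3
  have hM : HasSum (fun e : ℕ => correction e * e * divisorConvMain (x / e))
      (π ^ 2 / 12 * x ^ 2 * (∑' n : ℕ, correction n / n) +
          (1 / 2 * (1 - eulerMascheroniConstant - log (2 * π)) * x - x / 2 * log x -
            x / 2 * log 2) * ∑' n, correction n) := by
    have h4 := ((h2.mul_left (π ^ 2 / 12 * x ^ 2)).add (h1.mul_left
      (1 / 2 * (1 - eulerMascheroniConstant - log (2 * π)) * x - x / 2 * log x))).add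
      (h3.mul_left (x / 2))
    have hval : ∀ a b c l : ℝ, a + (b - x / 2 * l) * c = a + b * c + x / 2 * (-l * c) := by
      intro a b c l
      ring
    rw [hval]
    refine h4.congr_fun fun e => ?_
    rcases eq_or_ne e 0 with rfl | he
    · simp
    · have he' : (e : ℝ) ≠ 0 := by exact_mod_cast he
      rw [divisorConvMain, log_div hx.ne' he']
      field_simp
      ring
  have hD := hT.sub hM
  rw [← hD.tsum_eq, ← norm_eq_abs]
  refine (tsum_of_norm_bounded (hsum.hasSum.mul_left (K * x ^ s)) fun e => ?_).trans_eq (by ring)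
  rcases eq_or_ne e 0 with rfl | he
  · simp
  · have he' : (0 : ℝ) < e := by exact_mod_cast Nat.pos_of_ne_zero he
    have h5 := hle (x / e) (by positivity)
    rw [div_rpow hx.le he'.le] at h5
    rw [← mul_sub, norm_eq_abs, abs_mul, abs_mul, Nat.abs_cast, rpow_sub he', rpow_one]
    have h6 := mul_le_mul_of_nonneg_left h5 (show 0 ≤ |correction e| * e by positivity)
    refine h6.trans_eq ?_
    ring

/-- Lemma 2.1 (Montgomery–Soundararajan): for any `ε > 0`,
`Σ_{k=1}^h (h-k) 𝔖(k) = h²/2 - (h log h)/2 + A h + O(h^(1/2+ε))` where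
`A = (1 - C₀ - log 2π)/2`. -/
theorem singularSeries_weighted_sum_asymptotic (ε : ℝ) (hε : 0 < ε) :
    ∃ C : ℝ, 0 < C ∧ ∀ h : ℕ, 1 ≤ h →
      |(∑ k ∈ Finset.Icc 1 h, ((h : ℝ) - (k : ℝ)) * singularSeries k) -
        ((1 / 2) * (h : ℝ) ^ 2 - (1 / 2) * (h : ℝ) * Real.log h +
          (1 / 2) * (1 - Real.eulerMascheroniConstant - Real.log (2 * π)) * h)| ≤
        C * (h : ℝ) ^ ((1 : ℝ) / 2 + ε) := by
  obtain ⟨s, hs, hs1, hsε⟩ : ∃ s : ℝ, 1 / 2 < s ∧ s < 1 ∧ s ≤ 1 / 2 + ε :=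
    ⟨1 / 2 + min ε (1 / 4), by simp [hε], by linarith [min_le_right ε (1 / 4)],
      by linarith [min_le_left ε (1 / 4)]⟩
  obtain ⟨K, hK, hle⟩ := exists_abs_sum_correction_sub_le hs hs1
  refine ⟨|4 * twinConst| * K + 1, by positivity, fun h hh => ?_⟩
  have hh' : (1 : ℝ) ≤ h := by exact_mod_cast hh
  have hx : (0 : ℝ) < h / 2 := by linarith
  have hlog : log ((h : ℝ) / 2) = log h - log 2 := log_div (by linarith) two_ne_zero
  have h1 := tsum_correction_mul_twinConst
  have h2 := tsum_correction_div_mul_twinConst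
  have hb := mul_le_mul_of_nonneg_left (hle _ hx) (abs_nonneg (4 * twinConst))
  rw [← abs_mul, mul_sub, ← sum_singularSeries_eq, hlog] at hb
  have hmain : ∀ A G₁ G₂ c l l₂ y : ℝ, G₁ * c = 1 / 2 → G₂ * (π ^ 2 / 6) * c = 1 →
      4 * c * (π ^ 2 / 12 * (y / 2) ^ 2 * G₂ + (1 / 2 * A * (y / 2) - y / 2 / 2 * (l - l₂) -
        y / 2 / 2 * l₂) * G₁) = 1 / 2 * y ^ 2 - 1 / 2 * y * l + 1 / 2 * A * y := by
    intro A G₁ G₂ c l l₂ y e1 e2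
    linear_combination (A * y - y * l) * e1 + y ^ 2 / 2 * e2
  rw [hmain _ _ _ _ _ _ _ h1 h2] at hb
  refine hb.trans ?_
  have h3 : ((h : ℝ) / 2) ^ s ≤ (h : ℝ) ^ (1 / 2 + ε) :=
    (rpow_le_rpow hx.le (by linarith) (by linarith)).trans
      (rpow_le_rpow_of_exponent_le hh' hsε)
  have h4 : 0 ≤ (h : ℝ) ^ (1 / 2 + ε) := by positivity
  rw [← mul_assoc, add_mul, one_mul]
  have h5 := mul_le_mul_of_nonneg_left h3 (show 0 ≤ |4 * twinConst| * K by positivity)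
  linarith
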